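/- (Cyclic symmetry of tree amplitudes, eq. (3.25)) For every n ≥ 3 and all Φ¹, …, Φⁿ ∈ V₁, one has ⟨[[Φ¹, Φ², …, Φⁿ⁻¹]]_Δ, Φⁿ⟩ = ⟨[[Φ², Φ³, …, Φⁿ]]_Δ, Φ¹⟩. -/

import Mathlib

open scoped BigOperators

variable {R : Type*} [CommRing R] {V : Type*} [AddCommGroup V] [Module R V]

/-- Auxiliary fuelled definition of the string-field-theory bracket
`[[Φ¹, …, Φⁿ]]_Δ`: for a list `l` with `2 ≤ l.length ≤ fuel`, `brkAux st Δ fuel l`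
is the sum over all splittings `l = l₁ ++ l₂` into nonempty contiguous pieces of
`w l₁ ⋆ w l₂`, where `w m = m.head` if `m` is a singleton and `w m = Δ [[m]]` otherwise.
This reproduces the recursion
`[[Φ¹,…,Φᵏ]] = Φ¹ ⋆ Δ[[Φ²,…,Φᵏ]] + Δ[[Φ¹,…,Φᵏ⁻¹]] ⋆ Φᵏ
  + Σ_{m=2}^{k-2} Δ[[Φ¹,…,Φᵐ]] ⋆ Δ[[Φᵐ⁺¹,…,Φᵏ]]`. -/
def brkAux (st : V →ₗ[R] V →ₗ[R] V) (Δ : V →ₗ[R] V) : ℕ → List V → V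
  | 0, _ => 0
  | fuel + 1, l =>
      ∑ i ∈ Finset.Ico 1 l.length,
        st (if (l.take i).length = 1 then (l.take i).head?.getD 0
            else Δ (brkAux st Δ fuel (l.take i)))
           (if (l.drop i).length = 1 then (l.drop i).head?.getD 0
            else Δ (brkAux st Δ fuel (l.drop i)))

/-- The string-field-theory bracket `[[Φ¹, …, Φⁿ]]_Δ` of a list of string fields. -/
def brk (st : V →ₗ[R] V →ₗ[R] V) (Δ : V →ₗ[R] V) (l : List V) : V :=
  brkAux st Δ l.length l


theorem brkAux_fuel (st : V →ₗ[R] V →ₗ[R] V) (Δ : V →ₗ[R] V) :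
    ∀ (f g : ℕ) (l : List V), l.length ≤ f → l.length ≤ g →
      brkAux st Δ f l = brkAux st Δ g l := by
  intro f
  induction f with
  | zero =>
    intro g l hf hg
    have hl : l.length = 0 := by omega
    cases g <;> simp [brkAux, hl]
  | succ f ih =>
    intro g l hf hg
    cases g with
    | zero =>
      have hl : l.length = 0 := by omega
      simp [brkAux, hl]
    | succ g =>
      simp only [brkAux]
      refine Finset.sum_congr rfl fun i hi => ?_
      rw [Finset.mem_Ico] at hi
      rw [ih g (l.take i) (by rw [List.length_take]; omega) (by rw [List.length_take]; omega),
        ih g (l.drop i) (by rw [List.length_drop]; omega) (by rw [List.length_drop]; omega)]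

/-- The bracket of the fields with indices in `[a, c)`. -/
def segB (st : V →ₗ[R] V →ₗ[R] V) (Δ : V →ₗ[R] V) (Φ : ℕ → V) (a c : ℕ) : V :=
  brk st Δ ((List.range (c - a)).map fun i => Φ (i + a))

/-- The propagated bracket (or the field itself) on `[a, c)`. -/
def segW (st : V →ₗ[R] V →ₗ[R] V) (Δ : V →ₗ[R] V) (Φ : ℕ → V) (a c : ℕ) : V :=
  if c = a + 1 then Φ a else Δ (segB st Δ Φ a c)

theorem segB_eq (st : V →ₗ[R] V →ₗ[R] V) (Δ : V →ₗ[R] V) (Φ : ℕ → V) (a c : ℕ) :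
    segB st Δ Φ a c =
      ∑ k ∈ Finset.Ico (a + 1) c, st (segW st Δ Φ a k) (segW st Δ Φ k c) := by
  have key : ∀ l : List V, brk st Δ l = ∑ i ∈ Finset.Ico 1 l.length,
        st (if (l.take i).length = 1 then (l.take i).head?.getD 0
            else Δ (brk st Δ (l.take i)))
           (if (l.drop i).length = 1 then (l.drop i).head?.getD 0
            else Δ (brk st Δ (l.drop i))) := by
    intro l
    unfold brk
    rw [brkAux_fuel st Δ l.length (l.length + 1) l le_rfl (by omega)]
    rw [brkAux]
    refine Finset.sum_congr rfl fun i hi => ?_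
    rw [brkAux_fuel st Δ l.length (l.take i).length (l.take i)
        (by rw [List.length_take]; omega) le_rfl,
      brkAux_fuel st Δ l.length (l.drop i).length (l.drop i)
        (by rw [List.length_drop]; omega) le_rfl]
  have e : Finset.Ico (a + 1) c = (Finset.Ico 1 (c - a)).map (addRightEmbedding a) := by
    ext k
    simp only [Finset.mem_Ico, Finset.mem_map, addRightEmbedding_apply]
    constructor
    · intro h
      exact ⟨k - a, by omega, by omega⟩
    · rintro ⟨x, hx, rfl⟩
      omega
  rw [e, Finset.sum_map]
  conv_lhs => rw [segB, key]
  rw [List.length_map, List.length_range]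
  refine Finset.sum_congr rfl fun i hi => ?_
  rw [Finset.mem_Ico] at hi
  have h1 : ((List.range (c - a)).map fun i => Φ (i + a)).take i
      = (List.range (i + a - a)).map fun i => Φ (i + a) := by
    apply List.ext_getElem
    · simp; omega
    · intros; simp
  have h2 : ((List.range (c - a)).map fun i => Φ (i + a)).drop i
      = (List.range (c - (i + a))).map fun j => Φ (j + (i + a)) := by
    apply List.ext_getElem
    · simp; omega
    · intros
      simp only [List.getElem_drop, List.getElem_map, List.getElem_range]
      congr 1; omega
  rw [h1, h2, addRightEmbedding_apply]
  congr 1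
  · congr 1
    unfold segW
    by_cases h : i = 1
    · subst h
      have : 1 + a = a + 1 := by omega
      simp [this]
    · rw [if_neg (by simpa using h), if_neg (by omega)]
      rfl
  · unfold segW
    by_cases h : c = i + a + 1
    · subst h
      have : i + a + 1 - (i + a) = 1 := by omega
      simp [this]
    · rw [if_neg (by simp; omega), if_neg h]
      rfl

/-- **Cyclic symmetry of tree amplitudes, eq. (3.25).** For every n ≥ 3
and all odd Φ¹, …, Φⁿ ∈ V₁,
⟨[[Φ¹, Φ², …, Φⁿ⁻¹]]_Δ, Φⁿ⟩ = ⟨[[Φ², Φ³, …, Φⁿ]]_Δ, Φ¹⟩. -/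
theorem cyclic_symmetry_of_tree_amplitudes
    (V₀ V₁ : Submodule R V) (hVcompl : IsCompl V₀ V₁)
    (st : V →ₗ[R] V →ₗ[R] V)
    (hst00 : ∀ a ∈ V₀, ∀ b ∈ V₀, st a b ∈ V₀)
    (hst01 : ∀ a ∈ V₀, ∀ b ∈ V₁, st a b ∈ V₁)
    (hst10 : ∀ a ∈ V₁, ∀ b ∈ V₀, st a b ∈ V₁)
    (hst11 : ∀ a ∈ V₁, ∀ b ∈ V₁, st a b ∈ V₀)
    (Q : V →ₗ[R] V)
    (hQ01 : ∀ a ∈ V₀, Q a ∈ V₁) (hQ10 : ∀ a ∈ V₁, Q a ∈ V₀)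
    (hQQ : ∀ v, Q (Q v) = 0)
    (hLeib0 : ∀ a ∈ V₀, ∀ b, Q (st a b) = st (Q a) b + st a (Q b))
    (hLeib1 : ∀ a ∈ V₁, ∀ b, Q (st a b) = st (Q a) b - st a (Q b))
    (Δ : V →ₗ[R] V)
    (hΔ01 : ∀ a ∈ V₀, Δ a ∈ V₁) (hΔ10 : ∀ a ∈ V₁, Δ a ∈ V₀)
    (hprop : ∀ v, Q (Δ v) + Δ (Q v) = v)
    (pr : V →ₗ[R] V →ₗ[R] R)
    (hpr_symm : ∀ x y, pr x y = pr y x)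
    (hpr_Δ : ∀ x y, pr (Δ x) y = pr x (Δ y))
    (hpr_st : ∀ a b c, pr (st a b) c = pr a (st b c))
    (n : ℕ) (hn : 3 ≤ n) (Φ : ℕ → V) (hΦ : ∀ i < n, Φ i ∈ V₁) :
    pr (brk st Δ ((List.range (n - 1)).map Φ)) (Φ (n - 1)) =
      pr (brk st Δ ((List.range (n - 1)).map fun i => Φ (i + 1))) (Φ 0) := by
  have swap : ∑ j ∈ Finset.Ico 1 n, pr (segB st Δ Φ 0 j) (segW st Δ Φ j n) =
      ∑ k ∈ Finset.Ico 1 n, pr (segW st Δ Φ 0 k) (segB st Δ Φ k n) := by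
    simp only [segB_eq, map_sum, LinearMap.sum_apply, hpr_st]
    apply Finset.sum_comm'
    intro x y
    simp only [Finset.mem_Ico]
    omega
  have z1 : segB st Δ Φ 0 1 = 0 := by rw [segB_eq]; simp
  have z2 : segB st Δ Φ (n - 1) n = 0 := by
    rw [segB_eq, Finset.Ico_eq_empty (by omega), Finset.sum_empty]
  obtain ⟨m, rfl⟩ : ∃ m, n = m + 2 := ⟨n - 2, by omega⟩
  have split : ∀ f : ℕ → R, ∑ j ∈ Finset.Ico 1 (m + 2), f j =
      f 1 + ∑ j ∈ Finset.Ico (1 + 1) (m + 1), f j + f (m + 1) := by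
    intro f
    rw [Finset.sum_Ico_succ_top (by omega), Finset.sum_eq_sum_Ico_succ_bot (by omega)]
  rw [split, split] at swap
  have mid : ∑ j ∈ Finset.Ico (1 + 1) (m + 1), pr (segB st Δ Φ 0 j) (segW st Δ Φ j (m + 2)) =
      ∑ j ∈ Finset.Ico (1 + 1) (m + 1), pr (segW st Δ Φ 0 j) (segB st Δ Φ j (m + 2)) := by
    refine Finset.sum_congr rfl fun j hj => ?_
    rw [Finset.mem_Ico] at hj
    rw [segW, if_neg (by omega), segW, if_neg (by omega), hpr_Δ]
  have z2' : segB st Δ Φ (m + 1) (m + 2) = 0 := z2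
  have w1 : segW st Δ Φ 0 1 = Φ 0 := by simp [segW]
  have w2 : segW st Δ Φ (m + 1) (m + 2) = Φ (m + 1) := by simp [segW]
  rw [mid, z1, z2', w1, w2] at swap
  simp only [map_zero, LinearMap.zero_apply, zero_add, add_zero] at swap
  rw [add_comm, add_right_cancel_iff] at swap
  rw [hpr_symm _ (Φ 0)]
  exact swap
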